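/- Let H ∈ (1/2, 3/4), let Σ > 0 and let σ : [0,1] → ℝ be measurable with 0 ≤ σ(t) ≤ Σ for all t. For each N ≥ 1 define the covariance matrix c^N_{kj} = H(2H−1) ∫_{k/N}^{(k+1)/N} ∫_{j/N}^{(j+1)/N} σ(s) σ(t) |s − t|^{2H−2} dt ds for 0 ≤ k, j ≤ N−1, and let (η^N_0, …, η^N_{N−1}) be centered jointly Gaussian random variables on a probability space (Ω, F, P) with E[η^N_k η^N_j] = c^N_{kj}. Set θ̃_N = N^{2H−1} Σ_{k=0}^{N−1} c^N_{kk}, X_N = √N ( N^{2H−1} Σ_{k=0}^{N−1} (η^N_k)² − θ̃_N ), and S_N = 2 N^{4H−1} Σ_{k=0}^{N−1} Σ_{j=0}^{N−1} (c^N_{kj})². Assume S_N converges to a limit σ²_{H,2,*} > 0 as N → ∞. Then X_N converges in distribution to the centered normal law N(0, σ²_{H,2,*}). -/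

import Mathlib

open MeasureTheory ProbabilityTheory Filter Topology NNReal BoundedContinuousFunction

/-- The fourth moment of the standard normal law. -/
lemma integral_pow_four_gaussianReal : ∫ x, x ^ 4 ∂(gaussianReal 0 1) = 3 := by
  have key : iteratedDeriv 4 (mgf id (gaussianReal 0 1)) 0 = 3 := by
    rw [mgf_id_gaussianReal]
    have step (p q : ℝ → ℝ) (hp : ∀ t, HasDerivAt p (q t) t) :
        deriv (fun t => p t * Real.exp (0 * t + (1 : ℝ≥0) * t ^ 2 / 2)) =
          fun t => (q t + t * p t) * Real.exp (0 * t + (1 : ℝ≥0) * t ^ 2 / 2) := by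
      ext t
      have h : HasDerivAt (fun t : ℝ => 0 * t + (1 : ℝ≥0) * t ^ 2 / 2) t t := by
        simpa using ((hasDerivAt_pow 2 t).div_const 2)
      refine ((hp t).fun_mul h.exp).deriv.trans ?_
      ring
    have h1 := step (fun _ => 1) (fun _ => 0) fun t => hasDerivAt_const t 1
    have h2 := step (fun t => t) (fun _ => 1) hasDerivAt_id
    have h3 := step (fun t => 1 + t ^ 2) (fun t => 2 * t) fun t => by
      simpa using (hasDerivAt_pow 2 t).const_add 1
    have h4 := step (fun t => 3 * t + t ^ 3) (fun t => 3 + 3 * t ^ 2) fun t => by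
      simpa using ((hasDerivAt_id' t).const_mul 3).fun_add (hasDerivAt_pow 3 t)
    simp only [one_mul, mul_one, zero_add] at h1
    simp only [iteratedDeriv_succ, iteratedDeriv_zero]
    have e2 : (fun t : ℝ => (1 + t * t) * Real.exp (0 * t + (1 : ℝ≥0) * t ^ 2 / 2)) =
        fun t => (1 + t ^ 2) * Real.exp (0 * t + (1 : ℝ≥0) * t ^ 2 / 2) := by
      ext t; ring
    have e3 : (fun t : ℝ => (2 * t + t * (1 + t ^ 2)) *
        Real.exp (0 * t + (1 : ℝ≥0) * t ^ 2 / 2)) =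
        fun t => (3 * t + t ^ 3) * Real.exp (0 * t + (1 : ℝ≥0) * t ^ 2 / 2) := by
      ext t; ring
    rw [h1, h2, e2, h3, e3, h4]
    simp
  rw [iteratedDeriv_mgf_zero (by simp)] at key
  simpa using key

/-- The law of `(ξ² - 1) / √2` for a standard normal variable `ξ`. -/
noncomputable def chiSqLaw : Measure ℝ :=
  (gaussianReal 0 1).map fun x => (x ^ 2 - 1) / √2

instance : IsProbabilityMeasure chiSqLaw :=
  Measure.isProbabilityMeasure_map (by fun_prop)

lemma charFun_chiSqLaw_isLittleO :
    (fun t => charFun chiSqLaw t - (1 - t ^ 2 / 2)) =o[𝓝 0] fun t : ℝ => t ^ 2 := by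
  have hintegrable (n : ℕ) : Integrable (fun x : ℝ => x ^ n) (gaussianReal 0 1) :=
    ((memLp_id_gaussianReal n).integrable_norm_pow').mono' (by fun_prop)
      (ae_of_all _ fun x => by simp)
  have h2 : ∫ x, x ^ 2 ∂(gaussianReal 0 1) = 1 := by
    have h := variance_eq_integral (μ := gaussianReal 0 1) (X := fun x => x) (by fun_prop)
    rw [variance_fun_id_gaussianReal, integral_id_gaussianReal] at h
    simpa using h.symm
  refine taylor_charFun_two (by fun_prop) ?_ ?_
  · rw [integral_div, integral_sub (hintegrable 2) (integrable_const _), h2]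
    simp
  · have e : (fun x : ℝ => (x ^ 2 - 1) / √2) ^ 2 = fun x => (x ^ 4 - 2 * x ^ 2 + 1) / 2 := by
      ext x
      simp only [Pi.pow_apply, div_pow, Real.sq_sqrt zero_le_two]
      ring
    have hsub : Integrable (fun x : ℝ => x ^ 4 - 2 * x ^ 2) (gaussianReal 0 1) :=
      (hintegrable 4).sub ((hintegrable 2).const_mul 2)
    rw [e, integral_div, integral_add hsub (integrable_const _), integral_sub (hintegrable 4) ((hintegrable 2).const_mul 2), integral_const_mul,
      h2, integral_pow_four_gaussianReal]
    norm_num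

/-- The difference of two products of complex numbers of norm at most one is bounded by the sum of the
differences of the factors. -/
lemma norm_prod_sub_prod_le_sum {ι : Type*} [Fintype ι] {f g : ι → ℂ}
    (hf : ∀ i, ‖f i‖ ≤ 1) (hg : ∀ i, ‖g i‖ ≤ 1) :
    ‖∏ i, f i - ∏ i, g i‖ ≤ ∑ i, ‖f i - g i‖ := by
  classical
  have key (s : Finset ι) : ‖∏ i ∈ s, f i - ∏ i ∈ s, g i‖ ≤ ∑ i ∈ s, ‖f i - g i‖ := by
    induction s using Finset.induction_on with
    | empty => simp
    | insert i s hi ih =>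
      rw [Finset.prod_insert hi, Finset.prod_insert hi, Finset.sum_insert hi]
      have hs : ‖∏ j ∈ s, f j‖ ≤ 1 := by
        rw [norm_prod]
        exact Finset.prod_le_one (fun _ _ => norm_nonneg _) fun j _ => hf j
      calc _ = ‖(f i - g i) * ∏ j ∈ s, f j + g i * (∏ j ∈ s, f j - ∏ j ∈ s, g j)‖ := by
            congr 1; ring
        _ ≤ ‖f i - g i‖ * ‖∏ j ∈ s, f j‖ + ‖g i‖ * ‖∏ j ∈ s, f j - ∏ j ∈ s, g j‖ := by
            rw [← norm_mul, ← norm_mul]; exact norm_add_le _ _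
        _ ≤ ‖f i - g i‖ * 1 + 1 * ∑ j ∈ s, ‖f j - g j‖ := by
            gcongr
            exact hg i
        _ = _ := by ring
  exact key Finset.univ

/-- Products of values of `φ`, where `φ` has the second order expansion of the characteristic
function of a standardized law, along an infinitesimal array with converging sum of squares. -/
lemma tendsto_prod_of_isLittleO {φ : ℝ → ℂ} (hφ : ∀ t, ‖φ t‖ ≤ 1)
    (h : (fun t => φ t - (1 - t ^ 2 / 2)) =o[𝓝 0] fun t : ℝ => t ^ 2)
    {ι : ℕ → Type*} [∀ n, Fintype (ι n)] {a : ∀ n, ι n → ℝ} {r : ℕ → ℝ}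
    (hr : Tendsto r atTop (𝓝 0)) (har : ∀ᶠ n in atTop, ∀ i, |a n i| ≤ r n)
    {v : ℝ} (hv : Tendsto (fun n => ∑ i, a n i ^ 2) atTop (𝓝 v)) :
    Tendsto (fun n => ∏ i, φ (a n i)) atTop (𝓝 (Complex.exp (-(v / 2 : ℝ)))) := by
  set g : ℝ → ℂ := fun t => Complex.exp (-(t ^ 2 / 2 : ℝ)) with hg
  have hg1 (t : ℝ) : ‖g t‖ ≤ 1 := by
    rw [hg, Complex.norm_exp]
    simp only [Complex.neg_re, Complex.ofReal_re, Real.exp_le_one_iff]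
    nlinarith [sq_nonneg t]
  have hgo : (fun t => g t - (1 - t ^ 2 / 2)) =o[𝓝 0] fun t : ℝ => t ^ 2 := by
    have hO : (fun t : ℝ => g t - (1 - t ^ 2 / 2)) =O[𝓝 0] fun t : ℝ => t ^ 4 := by
      refine .of_bound 1 ?_
      filter_upwards [Metric.ball_mem_nhds (0 : ℝ) one_pos] with t ht
      have ht' : |t| < 1 := by simpa using ht
      have ht2 : t ^ 2 ≤ 1 := (sq_le_one_iff_abs_le_one t).2 ht'.le
      have hn : ‖(-(t ^ 2 / 2 : ℝ) : ℂ)‖ = t ^ 2 / 2 := by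
        rw [norm_neg, Complex.norm_real, Real.norm_of_nonneg (by positivity)]
      have := Complex.norm_exp_sub_one_sub_id_le (x := (-(t ^ 2 / 2 : ℝ) : ℂ)) (by
        rw [hn]; linarith)
      rw [hn] at this
      have e : g t - (1 - (t : ℂ) ^ 2 / 2) =
          Complex.exp (-(t ^ 2 / 2 : ℝ)) - 1 - (-(t ^ 2 / 2 : ℝ)) := by
        rw [hg]; push_cast; ring
      rw [e]
      refine this.trans ?_
      rw [Real.norm_of_nonneg (by positivity)]
      nlinarith [sq_nonneg (t ^ 2)]
    exact hO.trans_isLittleO (Asymptotics.isLittleO_pow_pow (by norm_num))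
  have hd : (fun t => φ t - g t) =o[𝓝 0] fun t : ℝ => t ^ 2 := by
    simpa using h.sub hgo
  have hprod (n : ℕ) : ∏ i, g (a n i) = Complex.exp (-((∑ i, a n i ^ 2) / 2 : ℝ)) := by
    rw [hg, ← Complex.exp_sum, Finset.sum_neg_distrib, Finset.sum_div]
    push_cast
    rfl
  have hglim : Tendsto (fun n => ∏ i, g (a n i)) atTop (𝓝 (Complex.exp (-(v / 2 : ℝ)))) := by
    simp_rw [hprod]
    exact (Complex.continuous_exp.tendsto _).comp
      ((Complex.continuous_ofReal.tendsto _).comp (hv.div_const 2)).neg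
  refine hglim.congr_dist ?_
  rw [Metric.tendsto_atTop]
  intro ε hε
  have hv1 : ∀ᶠ n in atTop, ∑ i, a n i ^ 2 < |v| + 1 :=
    hv.eventually_lt_const (by linarith [le_abs_self v])
  have hη : 0 < ε / (2 * (|v| + 1)) := by positivity
  obtain ⟨δ, hδ, hball⟩ := Metric.eventually_nhds_iff.1 (hd.def hη)
  have hrδ := hr.eventually_lt_const hδ
  obtain ⟨n₀, hn₀⟩ := eventually_atTop.1 (hv1.and (hrδ.and har))
  refine ⟨n₀, fun n hn => ?_⟩
  obtain ⟨h1, h2, h3⟩ := hn₀ n hn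
  have hle : dist (∏ i, g (a n i)) (∏ i, φ (a n i)) ≤
      ∑ i, ε / (2 * (|v| + 1)) * a n i ^ 2 := by
    rw [dist_comm, dist_eq_norm]
    refine (norm_prod_sub_prod_le_sum (fun i => hφ _) fun i => hg1 _).trans ?_
    refine Finset.sum_le_sum fun i _ => ?_
    have := hball (y := a n i) (by simpa using (h3 i).trans_lt h2)
    simpa using this
  rw [Real.dist_0_eq_abs, abs_of_nonneg dist_nonneg]
  refine hle.trans_lt ?_
  rw [← Finset.mul_sum]
  calc _ ≤ ε / (2 * (|v| + 1)) * (|v| + 1) := by gcongr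
    _ = ε / 2 := by field_simp
    _ < ε := by linarith

lemma intervalIntegrable_abs_rpow {p : ℝ} (hp : -1 < p) (a b : ℝ) :
    IntervalIntegrable (fun x : ℝ => |x| ^ p) volume a b := by
  refine intervalIntegrable_of_even (fun x => by simp) fun x hx => ?_
  refine (intervalIntegral.intervalIntegrable_rpow' hp).congr fun y hy => ?_
  rw [Set.uIoc_of_le hx.le] at hy
  simp [abs_of_pos hy.1]

/-- The row sums of the matrix of kernel integrals over the cells of the uniform partition of
`[0, 1]` are of order `1 / N`. -/
lemma sum_abs_integral_kernel_le {p M : ℝ} (hp : -1 < p) {f : ℝ → ℝ → ℝ}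
    (hf : ∀ s ∈ Set.Icc (0 : ℝ) 1, ∀ t ∈ Set.Icc (0 : ℝ) 1, |f s t| ≤ M * |s - t| ^ p)
    (hM : 0 ≤ M) {N k : ℕ} (hk : k < N) :
    ∑ j ∈ Finset.range N, |∫ s in ((k : ℝ) / N)..(((k : ℝ) + 1) / N),
        ∫ t in ((j : ℝ) / N)..(((j : ℝ) + 1) / N), f s t| ≤
      M * (∫ x in (-1 : ℝ)..1, |x| ^ p) / N := by
  have hN : (0 : ℝ) < N := by exact_mod_cast (Nat.zero_le k).trans_lt hk
  have hle (j : ℕ) : (j : ℝ) / N ≤ ((j : ℝ) + 1) / N := by gcongr; linarith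
  have hmem {j : ℕ} (hj : j < N) {t : ℝ} (ht : t ∈ Set.Ioc ((j : ℝ) / N) (((j : ℝ) + 1) / N)) :
      t ∈ Set.Icc (0 : ℝ) 1 := by
    refine ⟨le_trans (by positivity) ht.1.le, ht.2.trans ?_⟩
    rw [div_le_one hN]
    exact_mod_cast hj
  have hintegrable (s a b : ℝ) : IntervalIntegrable (fun t => |s - t| ^ p) volume a b := by
    simpa using (intervalIntegrable_abs_rpow hp (s - a) (s - b)).comp_sub_left s
  set g : ℕ → ℝ → ℝ := fun j s => ∫ t in ((j : ℝ) / N)..(((j : ℝ) + 1) / N), |s - t| ^ p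
  have hgc (j : ℕ) : Continuous (g j) := by
    have hc := intervalIntegral.continuous_primitive (μ := volume)
      (intervalIntegrable_abs_rpow hp) 0
    have e : g j = fun s => (∫ x in (0 : ℝ)..(s - j / N), |x| ^ p) -
        ∫ x in (0 : ℝ)..(s - (j + 1) / N), |x| ^ p := by
      ext s
      rw [intervalIntegral.integral_interval_sub_left (intervalIntegrable_abs_rpow hp _ _)
        (intervalIntegrable_abs_rpow hp _ _)]
      exact intervalIntegral.integral_comp_sub_left (fun x => |x| ^ p) s
    rw [e]
    exact (hc.comp (by fun_prop)).sub (hc.comp (by fun_prop))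
  have hgi (j : ℕ) (a b : ℝ) : IntervalIntegrable (fun s => M * g j s) volume a b :=
    ((hgc j).const_mul M).intervalIntegrable a b
  have hentry : ∀ j ∈ Finset.range N, |∫ s in ((k : ℝ) / N)..(((k : ℝ) + 1) / N),
        ∫ t in ((j : ℝ) / N)..(((j : ℝ) + 1) / N), f s t| ≤
      ∫ s in ((k : ℝ) / N)..(((k : ℝ) + 1) / N), M * g j s := fun j hj => by
    rw [← Real.norm_eq_abs]
    refine intervalIntegral.norm_integral_le_of_norm_le (hle k) (ae_of_all _ fun s hs => ?_)
      (hgi j _ _)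
    rw [← intervalIntegral.integral_const_mul]
    refine intervalIntegral.norm_integral_le_of_norm_le (hle j) (ae_of_all _ fun t ht => ?_)
      ((hintegrable s _ _).const_mul M)
    exact hf s (hmem hk hs) t (hmem (Finset.mem_range.1 hj) ht)
  have hsum (s : ℝ) : ∑ j ∈ Finset.range N, g j s = ∫ t in (0 : ℝ)..1, |s - t| ^ p := by
    have := intervalIntegral.sum_integral_adjacent_intervals (f := fun t => |s - t| ^ p)
      (μ := volume) (a := fun j : ℕ => (j : ℝ) / N) (n := N) fun j _ => hintegrable s _ _
    simpa [g, hN.ne'] using this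
  have hbound {s : ℝ} (hs : s ∈ Set.Icc (0 : ℝ) 1) :
      ∫ t in (0 : ℝ)..1, |s - t| ^ p ≤ ∫ x in (-1 : ℝ)..1, |x| ^ p := by
    rw [intervalIntegral.integral_comp_sub_left (fun x => |x| ^ p) s]
    refine intervalIntegral.integral_mono_interval (by linarith [hs.1]) (by linarith)
      (by linarith [hs.2]) (ae_of_all _ fun x => by positivity)
      (intervalIntegrable_abs_rpow hp _ _)
  refine (Finset.sum_le_sum hentry).trans ?_
  rw [← intervalIntegral.integral_finsetSum fun j _ => hgi j _ _]
  simp_rw [← Finset.mul_sum, hsum]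
  have hlast := intervalIntegral.norm_integral_le_of_norm_le_const
    (a := (k : ℝ) / N) (b := ((k : ℝ) + 1) / N) (C := M * ∫ x in (-1 : ℝ)..1, |x| ^ p)
    (f := fun s => M * ∫ t in (0 : ℝ)..1, |s - t| ^ p) fun s hs => by
      rw [Set.uIoc_of_le (hle k)] at hs
      rw [Real.norm_of_nonneg (mul_nonneg hM
        (intervalIntegral.integral_nonneg zero_le_one fun t _ => by positivity))]
      exact mul_le_mul_of_nonneg_left (hbound (hmem hk hs)) hM
  refine (le_abs_self _).trans (hlast.trans_eq ?_)
  rw [← _root_.sub_div, add_sub_cancel_left, abs_of_pos (by positivity), mul_one_div]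

/-- Orthogonal diagonalization of a real symmetric matrix `A`, with the bound of the eigenvalues by
the maximal row sum and the expression of the Frobenius norm through the eigenvalues. -/
lemma exists_orthogonal_diagonalization {ι : Type*} [Fintype ι] [DecidableEq ι]
    {A : Matrix ι ι ℝ} (hA : A.IsHermitian) :
    ∃ (U : Matrix ι ι ℝ) (l : ι → ℝ), U * U.transpose = 1 ∧
      U.transpose * A * U = Matrix.diagonal l ∧ ∑ i, l i ^ 2 = ∑ i, ∑ j, A i j ^ 2 ∧
      ∀ R, (∀ i, ∑ j, |A i j| ≤ R) → ∀ i, |l i| ≤ R := by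
  let U : Matrix ι ι ℝ := (hA.eigenvectorUnitary : Matrix ι ι ℝ)
  let l := hA.eigenvalues
  have hUU : U * U.transpose = 1 := by
    have := Unitary.coe_mul_star_self hA.eigenvectorUnitary
    simpa [Matrix.star_eq_conjTranspose] using this
  have hUU' : U.transpose * U = 1 := mul_eq_one_comm.1 hUU
  have hspec : A = U * Matrix.diagonal l * U.transpose := by
    have h := hA.spectral_theorem
    rw [Unitary.conjStarAlgAut_apply] at h
    simpa [Matrix.star_eq_conjTranspose, Function.comp_def] using h
  have hAU : A * U = U * Matrix.diagonal l := by
    conv_lhs => rw [hspec]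
    rw [Matrix.mul_assoc, hUU', Matrix.mul_one]
  refine ⟨U, l, hUU, ?_, ?_, fun R hR i => ?_⟩
  · rw [Matrix.mul_assoc, hAU, ← Matrix.mul_assoc, hUU', Matrix.one_mul]
  · have h1 : (A * A).trace = ∑ i, ∑ j, A i j ^ 2 := by
      simp only [Matrix.trace, Matrix.diag_apply, Matrix.mul_apply]
      refine Finset.sum_congr rfl fun i _ => Finset.sum_congr rfl fun j _ => ?_
      have : A j i = A i j := by simpa using hA.apply i j
      rw [this, sq]
    have h2 : A * A = U * (Matrix.diagonal l * Matrix.diagonal l * U.transpose) := by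
      conv_lhs => rw [hspec]
      calc _ = U * Matrix.diagonal l * (U.transpose * U) * Matrix.diagonal l * U.transpose := by
            simp only [Matrix.mul_assoc]
        _ = _ := by rw [hUU']; simp only [Matrix.mul_assoc, Matrix.mul_one]
    rw [← h1, h2, Matrix.trace_mul_comm, Matrix.mul_assoc, hUU', Matrix.mul_one,
      Matrix.diagonal_mul_diagonal, Matrix.trace_diagonal]
    simp [sq]
  · have : Nonempty ι := ⟨i⟩
    obtain ⟨k, hk⟩ := Finite.exists_max fun k => |U k i|
    have hpos : 0 < |U k i| := by
      by_contra! h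
      have hz (j : ι) : U j i = 0 := abs_nonpos_iff.1 ((hk j).trans h)
      have := congrFun (congrFun hUU' i) i
      simp [Matrix.mul_apply, hz] at this
    have he : ∑ j, A k j * U j i = U k i * l i := by
      have := congrFun (congrFun hAU k) i
      simpa [Matrix.mul_apply, Matrix.diagonal_apply] using this
    refine le_of_mul_le_mul_left ?_ hpos
    calc |U k i| * |l i| = |∑ j, A k j * U j i| := by rw [he, abs_mul]
      _ ≤ ∑ j, |A k j| * |U k i| := by
        refine (Finset.abs_sum_le_sum_abs _ _).trans (Finset.sum_le_sum fun j _ => ?_)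
        rw [abs_mul]
        exact mul_le_mul_of_nonneg_left (hk j) (abs_nonneg _)
      _ ≤ R * |U k i| := by rw [← Finset.sum_mul]; gcongr; exact hR k
      _ = _ := mul_comm _ _

/-- The characteristic function of a centered Gaussian quadratic functional. -/
lemma exists_charFun_quadratic_eq_prod {Ω : Type*} [MeasurableSpace Ω] {P : Measure Ω}
    {ι : Type*} [Fintype ι] [DecidableEq ι] {Y : ι → Ω → ℝ}
    (hY : HasGaussianLaw (fun ω => (Y · ω)) P) (h0 : ∀ i, ∫ ω, Y i ω ∂P = 0)
    {A : Matrix ι ι ℝ} (hA : ∀ i j, ∫ ω, Y i ω * Y j ω ∂P = A i j) :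
    ∃ l : ι → ℝ, ∑ i, l i ^ 2 = ∑ i, ∑ j, A i j ^ 2 ∧
      (∀ R, (∀ i, ∑ j, |A i j| ≤ R) → ∀ i, |l i| ≤ R) ∧
      ∀ m t : ℝ, charFun (P.map fun ω => m * (∑ i, Y i ω ^ 2 - ∑ i, A i i)) t =
        ∏ i, charFun chiSqLaw (t * (m * (√2 * l i))) := by
  have := hY.isProbabilityMeasure
  have hherm : A.IsHermitian := by
    ext i j
    simp [← hA, mul_comm]
  obtain ⟨U, l, hUU, hdiag, hsq, hbd⟩ := exists_orthogonal_diagonalization hherm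
  refine ⟨l, hsq, hbd, fun m t => ?_⟩
  have hmem (i : ι) : MemLp (Y i) 2 P := (hY.eval i).memLp_two
  let Z : ι → Ω → ℝ := fun i ω => ∑ k, U k i * Y k ω
  let L : (ι → ℝ) →L[ℝ] (ι → ℝ) := LinearMap.toContinuousLinearMap (Matrix.toLin' U.transpose)
  have hZ : HasGaussianLaw (fun ω => (Z · ω)) P := by
    refine (hY.map_fun L).congr (ae_of_all _ fun ω => ?_)
    ext i
    simp [L, Z, Matrix.mulVec, dotProduct]
  have hZ0 (i : ι) : ∫ ω, Z i ω ∂P = 0 := by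
    rw [integral_finsetSum _ fun k _ => ((hmem k).integrable one_le_two).const_mul _]
    simp [integral_const_mul, h0]
  have hZZ (i j : ι) : ∫ ω, Z i ω * Z j ω ∂P = Matrix.diagonal l i j := by
    have hi (k k' : ι) : Integrable (fun ω => U k i * Y k ω * (U k' j * Y k' ω)) P :=
      ((hmem k).const_mul _).integrable_mul ((hmem k').const_mul _)
    simp only [Z, Finset.sum_mul_sum]
    rw [integral_finsetSum _ fun k _ => integrable_finsetSum _ fun k' _ => hi k k', ← hdiag]
    simp only [Matrix.mul_apply, Matrix.transpose_apply, Finset.sum_mul]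
    rw [Finset.sum_comm]
    refine Finset.sum_congr rfl fun k _ => ?_
    rw [integral_finsetSum _ fun k' _ => hi k k']
    refine Finset.sum_congr rfl fun k' _ => ?_
    calc _ = ∫ ω, U k i * U k' j * (Y k ω * Y k' ω) ∂P := by
          congr 1; ext ω; ring
      _ = _ := by rw [integral_const_mul, hA]; ring
  have hZmem (i : ι) : MemLp (Z i) 2 P := (hZ.eval i).memLp_two
  have hind : iIndepFun Z P := hZ.iIndepFun_of_covariance_eq_zero fun i j hij => by
    rw [covariance_eq_sub (hZmem i) (hZmem j), hZ0]
    simpa [hij] using hZZ i j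
  have hl (i : ι) : 0 ≤ l i := by
    have h : ∫ ω, Z i ω * Z i ω ∂P = l i := by simpa using hZZ i i
    rw [← h]
    exact integral_nonneg fun ω => mul_self_nonneg _
  have hZlaw (i : ι) : P.map (Z i) = (gaussianReal 0 1).map fun x => √(l i) * x := by
    have hvar : Var[Z i; P] = l i := by
      rw [← covariance_self (hZ.eval i).aemeasurable, covariance_eq_sub (hZmem i) (hZmem i), hZ0]
      simpa using hZZ i i
    rw [(hZ.eval i).map_eq_gaussianReal, hZ0, hvar, gaussianReal_map_const_mul]
    congr 1
    · simp
    · ext; simp [hl i]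
  have hquad (ω : Ω) : m * (∑ i, Y i ω ^ 2 - ∑ i, A i i) = ∑ i, m * (Z i ω ^ 2 - l i) := by
    have e1 : ∑ i, Y i ω ^ 2 = ∑ i, Z i ω ^ 2 := by
      have : (U.transpose.mulVec (Y · ω)) ⬝ᵥ (U.transpose.mulVec (Y · ω)) =
          (Y · ω) ⬝ᵥ (Y · ω) := by
        rw [Matrix.dotProduct_mulVec, Matrix.vecMul_transpose, Matrix.mulVec_mulVec, hUU,
          Matrix.one_mulVec]
      simpa [dotProduct, Matrix.mulVec, Z, sq] using this.symm
    have e2 : ∑ i, A i i = ∑ i, l i := by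
      have := congrArg Matrix.trace hdiag
      rw [Matrix.trace_mul_comm, ← Matrix.mul_assoc, hUU, Matrix.one_mul,
        Matrix.trace_diagonal] at this
      simpa [Matrix.trace] using this
    rw [e1, e2, ← Finset.sum_sub_distrib, Finset.mul_sum]
  have hZm (i : ι) : AEMeasurable (Z i) P := (hZ.eval i).aemeasurable
  simp_rw [hquad]
  have hind' : iIndepFun (fun i ω => m * (Z i ω ^ 2 - l i)) P :=
    hind.comp (fun i x => m * (x ^ 2 - l i)) fun i => by fun_prop
  rw [hind'.charFun_map_fun_sum_eq_prod fun i => by have := hZm i; fun_prop, Finset.prod_apply]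
  refine Finset.prod_congr rfl fun i _ => ?_
  have e1 : P.map (fun ω => m * (Z i ω ^ 2 - l i)) =
      chiSqLaw.map fun x => m * (√2 * l i) * x := by
    calc P.map (fun ω => m * (Z i ω ^ 2 - l i))
        = (P.map (Z i)).map fun x => m * (x ^ 2 - l i) :=
          (AEMeasurable.map_map_of_aemeasurable (g := fun x => m * (x ^ 2 - l i))
            (by fun_prop) (hZm i)).symm
      _ = _ := by
        rw [hZlaw, chiSqLaw, Measure.map_map (by fun_prop) (by fun_prop),
          Measure.map_map (by fun_prop) (by fun_prop)]
        congr 1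
        ext x
        simp only [Function.comp_apply, mul_pow, Real.sq_sqrt (hl i)]
        field_simp
  rw [e1, charFun_map_mul, mul_comm t]

/-- Finitely many real random variables all of whose linear combinations are centered Gaussian are
jointly Gaussian. -/
lemma hasGaussianLaw_of_forall_sum {Ω : Type*} [MeasurableSpace Ω] {P : Measure Ω}
    {ι : Type*} [Fintype ι] [DecidableEq ι] {Y : ι → Ω → ℝ}
    (h : ∀ a : ι → ℝ, ∃ v : ℝ≥0, P.map (fun ω => ∑ i, a i * Y i ω) = gaussianReal 0 v) :
    HasGaussianLaw (fun ω => (Y · ω)) P ∧ ∀ i, ∫ ω, Y i ω ∂P = 0 := by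
  have hmarg (i : ι) : ∃ v : ℝ≥0, P.map (Y i) = gaussianReal 0 v := by
    simpa [Pi.single_apply] using h (Pi.single i 1)
  have hm (i : ι) : AEMeasurable (Y i) P := by
    obtain ⟨v, hv⟩ := hmarg i
    refine AEMeasurable.of_map_ne_zero ?_
    rw [hv]
    exact IsProbabilityMeasure.ne_zero _
  have hmY : AEMeasurable (fun ω => (Y · ω)) P := aemeasurable_pi_lambda _ hm
  refine ⟨⟨isGaussian_of_map_eq_gaussianReal fun L => ?_⟩, fun i => ?_⟩
  · obtain ⟨v, hv⟩ := h fun i => L (Pi.single i 1)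
    refine ⟨0, v, ?_⟩
    rw [← hv, AEMeasurable.map_map_of_aemeasurable (by fun_prop) hmY]
    congr 1
    ext ω
    change L (fun i => Y i ω) = _
    conv_lhs => rw [← Finset.univ_sum_single (fun i => Y i ω), map_sum]
    refine Finset.sum_congr rfl fun i _ => ?_
    have : (Pi.single i (Y i ω) : ι → ℝ) = Y i ω • Pi.single i 1 := by
      rw [← Pi.single_smul, smul_eq_mul, mul_one]
    rw [this, map_smul, smul_eq_mul, mul_comm]
  · obtain ⟨v, hv⟩ := hmarg i
    have := integral_map (f := fun x : ℝ => x) (hm i) (by fun_prop)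
    rw [← this, hv, integral_id_gaussianReal]

/-- CLT for the normalized quadratic functional of the triangular
Gaussian array arising from time-varying volatility: X_N ⇒ N(0, σ²_{H,2,*}). -/
theorem clt_time_varying_vol_gaussian_array
    {Ω : Type*} [MeasurableSpace Ω] (P : Measure Ω) [IsProbabilityMeasure P]
    (H : ℝ) (hH : H ∈ Set.Ioo (1/2 : ℝ) (3/4))
    (Λ : ℝ) (hΛ : 0 < Λ)
    (σ : ℝ → ℝ) (hσmeas : Measurable σ)
    (hσbd : ∀ t ∈ Set.Icc (0:ℝ) 1, 0 ≤ σ t ∧ σ t ≤ Λ)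
    -- the covariance matrix c^N_{kj}
    (c : ℕ → ℕ → ℕ → ℝ)
    (hc : ∀ N k j : ℕ, c N k j = H * (2*H - 1) *
      ∫ s in ((k : ℝ)/N)..(((k : ℝ) + 1)/N),
        ∫ t in ((j : ℝ)/N)..(((j : ℝ) + 1)/N), σ s * σ t * |s - t| ^ (2*H - 2))
    -- the triangular array (η^N_0, …, η^N_{N−1}) of centered jointly Gaussian r.v.'s
    (η : ℕ → ℕ → Ω → ℝ)
    (hGauss : ∀ (N : ℕ) (a : ℕ → ℝ),
      ∃ v : ℝ≥0, P.map (fun ω => ∑ k ∈ Finset.range N, a k * η N k ω) = gaussianReal 0 v)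
    (hCov : ∀ N : ℕ, ∀ k < N, ∀ j < N, ∫ ω, η N k ω * η N j ω ∂P = c N k j)
    -- centering constants and the statistic X_N
    (θ : ℕ → ℝ)
    (hθ : ∀ N : ℕ, θ N = (N : ℝ) ^ (2*H - 1) * ∑ k ∈ Finset.range N, c N k k)
    (X : ℕ → Ω → ℝ)
    (hX : ∀ (N : ℕ) (ω : Ω), X N ω = Real.sqrt N *
      ((N : ℝ) ^ (2*H - 1) * ∑ k ∈ Finset.range N, (η N k ω)^2 - θ N))
    -- the variances S_N and their limit σ²_{H,2,*} > 0
    (S : ℕ → ℝ)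
    (hS : ∀ N : ℕ, S N = 2 * (N : ℝ) ^ (4*H - 1) *
      ∑ k ∈ Finset.range N, ∑ j ∈ Finset.range N, (c N k j)^2)
    (v : ℝ≥0) (hv : 0 < v)
    (hlim : Tendsto S atTop (𝓝 (v : ℝ))) :
    -- conclusion: X_N converges in distribution to N(0, σ²_{H,2,*})
    ∀ f : ℝ →ᵇ ℝ,
      Tendsto (fun N : ℕ => ∫ ω, f (X N ω) ∂P)
        atTop (𝓝 (∫ x, f x ∂(gaussianReal 0 v))) := by
  obtain ⟨hH1, hH2⟩ := hH
  have hp : -1 < 2 * H - 2 := by linarith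
  have hHH : 0 ≤ H * (2 * H - 1) := mul_nonneg (by linarith) (by linarith)
  set K : ℝ := H * (2 * H - 1) * (Λ * Λ * ∫ x in (-1 : ℝ)..1, |x| ^ (2 * H - 2)) with hK
  have hrow {N k : ℕ} (hk : k < N) : ∑ j ∈ Finset.range N, |c N k j| ≤ K / N := by
    have hker : ∀ s ∈ Set.Icc (0 : ℝ) 1, ∀ t ∈ Set.Icc (0 : ℝ) 1,
        |σ s * σ t * |s - t| ^ (2 * H - 2)| ≤ Λ * Λ * |s - t| ^ (2 * H - 2) := fun s hs t ht => by
      obtain ⟨hs0, hs1⟩ := hσbd s hs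
      obtain ⟨ht0, ht1⟩ := hσbd t ht
      rw [abs_of_nonneg (by positivity)]
      gcongr
    have h := sum_abs_integral_kernel_le hp hker (by positivity) hk
    simp_rw [hc, abs_mul (H * (2 * H - 1)), abs_of_nonneg hHH, ← Finset.mul_sum]
    rw [hK, mul_div_assoc]
    exact mul_le_mul_of_nonneg_left h hHH
  have hG (N : ℕ) := hasGaussianLaw_of_forall_sum (P := P) (Y := fun (i : Fin N) => η N i)
    fun a => by
      obtain ⟨w, hw⟩ := hGauss N fun k => if hk : k < N then a ⟨k, hk⟩ else 0
      refine ⟨w, ?_⟩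
      simpa [Finset.sum_range] using hw
  choose l hlsq hlbd hlchar using fun N => exists_charFun_quadratic_eq_prod (hG N).1 (hG N).2
    (A := Matrix.of fun i j : Fin N => c N i j) fun i j => hCov N i i.2 j j.2
  have hXm (N : ℕ) : X N = fun ω => (√N * (N : ℝ) ^ (2 * H - 1)) *
      (∑ i : Fin N, η N i ω ^ 2 - ∑ i : Fin N, c N i i) := by
    ext ω
    rw [hX, hθ, Finset.sum_range, Finset.sum_range]
    ring
  have hXmeas (N : ℕ) : AEMeasurable (X N) P := by
    rw [hXm]
    have (i : Fin N) : AEMeasurable (η N i) P := ((hG N).1.eval i).aemeasurable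
    fun_prop
  have hscale {N : ℕ} (hN : 0 < N) :
      √N * (N : ℝ) ^ (2 * H - 1) = (N : ℝ) ^ (2 * H - 1 / 2) := by
    rw [Real.sqrt_eq_rpow, ← Real.rpow_add (by exact_mod_cast hN)]
    ring_nf
  let r : ℕ → ℝ := fun N => √2 * K * (N : ℝ) ^ (-(3 / 2 - 2 * H))
  have hr : Tendsto r atTop (𝓝 0) := by
    have := ((tendsto_rpow_neg_atTop (y := 3 / 2 - 2 * H) (by linarith)).comp
      tendsto_natCast_atTop_atTop).const_mul (√2 * K)
    simpa [r, Function.comp_def] using this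
  have hal : ∀ᶠ N : ℕ in atTop, ∀ i, |√N * (N : ℝ) ^ (2 * H - 1) * (√2 * l N i)| ≤ r N := by
    filter_upwards [eventually_gt_atTop 0] with N hN i
    have hN' : (0 : ℝ) < N := by exact_mod_cast hN
    have hli : |l N i| ≤ K / N := hlbd N _ (fun k => by
      simpa [Finset.sum_range] using hrow k.2) i
    rw [hscale hN, abs_mul, abs_mul, abs_of_nonneg (by positivity : 0 ≤ √2),
      abs_of_nonneg (by positivity)]
    calc _ ≤ (N : ℝ) ^ (2 * H - 1 / 2) * (√2 * (K / N)) := by gcongr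
      _ = √2 * K * ((N : ℝ) ^ (2 * H - 1 / 2) * (N : ℝ) ^ (-1 : ℝ)) := by
        rw [Real.rpow_neg_one]; ring
      _ = r N := by rw [← Real.rpow_add hN']; simp only [r]; ring_nf
  have hsum {N : ℕ} (hN : 0 < N) :
      ∑ i, (√N * (N : ℝ) ^ (2 * H - 1) * (√2 * l N i)) ^ 2 = S N := by
    have hN' : (0 : ℝ) < N := by exact_mod_cast hN
    have hsq : ((N : ℝ) ^ (2 * H - 1 / 2)) ^ 2 = (N : ℝ) ^ (4 * H - 1) := by
      rw [← Real.rpow_natCast, ← Real.rpow_mul hN'.le]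
      ring_nf
    simp_rw [hscale hN, mul_pow, Real.sq_sqrt zero_le_two, hsq, ← Finset.mul_sum, hlsq, hS,
      Finset.sum_range, Matrix.of_apply]
    ring
  let μ : ℕ → ProbabilityMeasure ℝ := fun N =>
    ⟨P.map (X N), Measure.isProbabilityMeasure_map (hXmeas N)⟩
  let μ₀ : ProbabilityMeasure ℝ := ⟨gaussianReal 0 v, inferInstance⟩
  have hconv : Tendsto μ atTop (𝓝 μ₀) := by
    refine ProbabilityMeasure.tendsto_iff_tendsto_charFun.2 fun t => ?_
    have hlim' : Tendsto (fun N : ℕ => ∑ i, (t * (√N * (N : ℝ) ^ (2 * H - 1) * (√2 * l N i))) ^ 2)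
        atTop (𝓝 (t ^ 2 * v)) := by
      refine (hlim.const_mul (t ^ 2)).congr' ?_
      filter_upwards [eventually_gt_atTop 0] with N hN
      simp_rw [mul_pow t, ← Finset.mul_sum, hsum hN]
    have h := tendsto_prod_of_isLittleO norm_charFun_le_one
      charFun_chiSqLaw_isLittleO (r := fun N => |t| * r N) (by simpa using hr.const_mul |t|)
      (hal.mono fun N hN i => by
        rw [abs_mul]
        exact mul_le_mul_of_nonneg_left (hN i) (abs_nonneg t))
      hlim'
    have e₀ : charFun (μ₀ : Measure ℝ) t = Complex.exp (-(t ^ 2 * v / 2 : ℝ)) := by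
      change charFun (gaussianReal 0 v) t = _
      rw [charFun_gaussianReal]
      push_cast
      ring_nf
    rw [e₀]
    refine h.congr fun N => ?_
    change _ = charFun (P.map (X N)) t
    rw [hXm, ← hlchar N]
    rfl
  intro f
  have h := ProbabilityMeasure.tendsto_iff_forall_integral_tendsto.1 hconv f
  refine h.congr fun N => ?_
  exact integral_map (hXmeas N) f.continuous.aestronglyMeasurable
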